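/- arXiv:math/0703867 — 2 statements merged into one kernel-verified Lean document; each statement's English description precedes it below -/
import Mathlib

section
/- Let A be a finite set with k ≥ 2 elements and let B_1 be the clone consisting of all essentially at most unary operations and all quasilinear operations on A. Then the B_1-subfunction quasiorder satisfies the descending chain condition: there is no infinite sequence (f_n) of operations on A such that f_{n+1} is a proper B_1-subfunction of f_n for every n. -/
namespace PaperSubfn

/-- A finitary operation on `A`: an arity `n` together with a map `(Fin n → A) → A`. -/
abbrev Op (A : Type*) := Σ n : ℕ, (Fin n → A) → A

variable {A : Type*}

/-- `f` is a `C`-subfunction of `g`: `f = g(h₁, …, h_m)` with all `h_i ∈ C`. -/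
def Subfn (C : Set (Op A)) (f g : Op A) : Prop :=
  ∃ h : Fin g.1 → ((Fin f.1 → A) → A),
    (∀ i, (⟨f.1, h i⟩ : Op A) ∈ C) ∧ ∀ a, f.2 a = g.2 fun i => h i a

/-- `f` and `g` are `C`-equivalent. -/
def EquivC (C : Set (Op A)) (f g : Op A) : Prop :=
  Subfn C f g ∧ Subfn C g f

/-- `f` is a proper `C`-subfunction of `g`. -/
def ProperSubfn (C : Set (Op A)) (f g : Op A) : Prop :=
  Subfn C f g ∧ ¬ Subfn C g f

/-- `f` and `g` are `C`-incomparable. -/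
def Incomp (C : Set (Op A)) (f g : Op A) : Prop :=
  ¬ Subfn C f g ∧ ¬ Subfn C g f

/-- The `n`-ary `i`-th projection. -/
def proj (A : Type*) (n : ℕ) (i : Fin n) : Op A := ⟨n, fun a => a i⟩

/-- `C` is closed under functional composition. -/
def ClosedComp (C : Set (Op A)) : Prop :=
  ∀ (n m : ℕ) (f : (Fin n → A) → A) (g : Fin n → (Fin m → A) → A),
    (⟨n, f⟩ : Op A) ∈ C → (∀ i, (⟨m, g i⟩ : Op A) ∈ C) →
      (⟨m, fun a => f fun i => g i a⟩ : Op A) ∈ C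

/-- A clone: contains all projections and is closed under composition. -/
def IsClone (C : Set (Op A)) : Prop :=
  (∀ n i, proj A n i ∈ C) ∧ ClosedComp C

/-- The clone generated by a set of operations. -/
def cloneGen (S : Set (Op A)) : Set (Op A) :=
  ⋂₀ {C : Set (Op A) | IsClone C ∧ S ⊆ C}

/-- The `i`-th variable is essential in `f`. -/
def essAt {n : ℕ} (f : (Fin n → A) → A) (i : Fin n) : Prop :=
  ∃ a b : Fin n → A, (∀ j, j ≠ i → a j = b j) ∧ f a ≠ f b

/-- The set of essential variables. -/
def essSet {n : ℕ} (f : (Fin n → A) → A) : Set (Fin n) := {i | essAt f i}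

/-- The essential arity of an operation. -/
noncomputable def essArity (f : Op A) : ℕ := (essSet f.2).ncard

/-- `f` is essentially at most unary. -/
def EssUnary (f : Op A) : Prop := (essSet f.2).Subsingleton

/-- The range of an operation. -/
def rng (f : Op A) : Set A := Set.range f.2

/-- Quasilinear operations: `f = g(h₁(x₁) ⊕ ⋯ ⊕ h_n(x_n))`. -/
def Quasilinear (f : Op A) : Prop :=
  ∃ (h : Fin f.1 → A → ZMod 2) (g : ZMod 2 → A),
    ∀ a, f.2 a = g (∑ i, h i (a i))

/-- The class of all unary operations. -/
def unaries (A : Type*) : Set (Op A) := {f : Op A | f.1 = 1}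

/-- The chain of clones `B_0 ⊂ B_1 ⊂ ⋯ ⊂ B_k` containing all unary operations. -/
def B (A : Type*) : ℕ → Set (Op A)
  | 0 => cloneGen (unaries A)
  | 1 => {f : Op A | EssUnary f ∨ Quasilinear f}
  | (i + 2) => {f : Op A | EssUnary f ∨ (rng f).ncard ≤ i + 2}

section Aux
open Finset

theorem eq_of_agree {n : ℕ} (f : (Fin n → A) → A) (a b : Fin n → A)
    (h : ∀ j, essAt f j → a j = b j) : f a = f b := by
  classical
  have key : ∀ s : Finset (Fin n), f (fun j => if j ∈ s then b j else a j) = f a := by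
    intro s
    induction s using Finset.induction_on with
    | empty => simp
    | insert i s hi ih =>
      rw [← ih]
      by_contra hne
      by_cases hab : a i = b i
      · apply hne
        congr 1
        funext j
        by_cases hj : j = i
        · subst hj; simp [hi, hab]
        · simp [hj]
      · apply hab
        apply h
        refine ⟨_, _, ?_, hne⟩
        intro j hj
        simp [hj]
  have := key Finset.univ
  simpa using this.symm

theorem mem_B1 (f : Op A) : f ∈ B A 1 ↔ EssUnary f ∨ Quasilinear f := Iff.rfl

theorem b1_unary {n : ℕ} (j : Fin n) (u : A → A) : (⟨n, fun a => u (a j)⟩ : Op A) ∈ B A 1 := by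
  left
  have : ∀ i ∈ essSet (fun a : Fin n → A => u (a j)), i = j := by
    rintro i ⟨a, b, hab, hne⟩
    by_contra hij
    exact hne (by simp only [hab j (Ne.symm hij)])
  intro x hx y hy
  rw [this x hx, this y hy]

theorem b1_const {n : ℕ} (c : A) : (⟨n, fun _ => c⟩ : Op A) ∈ B A 1 :=
  Or.inr ⟨fun _ _ => 0, fun _ => c, fun _ => rfl⟩

theorem b1_cases {n : ℕ} (z : A) (f : (Fin n → A) → A) (hf : (⟨n, f⟩ : Op A) ∈ B A 1) :
    (∃ (j : Fin n) (u : A → A), ∀ a, f a = u (a j)) ∨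
    (∃ (h : Fin n → A → ZMod 2) (g : ZMod 2 → A), ∀ a, f a = g (∑ i, h i (a i))) := by
  rcases hf with hf | hf
  · by_cases he : ∃ j, essAt f j
    · obtain ⟨j, hj⟩ := he
      left
      refine ⟨j, fun x => f fun _ => x, fun a => ?_⟩
      apply eq_of_agree
      intro i hi
      have : i = j := hf hi hj
      rw [this]
    · right
      refine ⟨fun _ _ => 0, fun _ => f fun _ => z, fun a => ?_⟩
      apply eq_of_agree
      intro i hi
      exact (he ⟨i, hi⟩).elim
  · right; exact hf

theorem b1_affine {n : ℕ} (z : A) (f : (Fin n → A) → A) (hf : (⟨n, f⟩ : Op A) ∈ B A 1)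
    (φ : A → ZMod 2) :
    ∃ (c : ZMod 2) (ψ : Fin n → A → ZMod 2), ∀ a, φ (f a) = c + ∑ j, ψ j (a j) := by
  classical
  rcases b1_cases z f hf with ⟨j, u, h⟩ | ⟨h, g, hg⟩
  · refine ⟨0, fun i x => if i = j then φ (u x) else 0, fun a => ?_⟩
    simp [h]
  · refine ⟨φ (g 0), fun i x => (φ (g 1) - φ (g 0)) * h i x, fun a => ?_⟩
    rw [hg, ← Finset.mul_sum]
    generalize ∑ i, h i (a i) = s
    have : s = 0 ∨ s = 1 := by revert s; decide
    rcases this with rfl | rfl <;> ring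

theorem b1_closed (z : A) : ClosedComp (B A 1) := by
  intro n m f g hf hg
  rcases b1_cases z f hf with ⟨j, u, h⟩ | ⟨h, w, hw⟩
  · rcases b1_cases z (g j) (hg j) with ⟨i, v, hv⟩ | ⟨h', w, hw⟩
    · have : (fun a => f fun i => g i a) = fun a : Fin m → A => (u ∘ v) (a i) := by
        funext a; simp [h, hv]
      rw [this]
      exact b1_unary i _
    · right
      refine ⟨h', u ∘ w, fun a => ?_⟩
      simp [h, hw]
  · right
    choose c ψ hψ using fun i => b1_affine z (g i) (hg i) (h i)
    refine ⟨fun j x => ∑ i, ψ i j x, fun s => w ((∑ i, c i) + s), fun a => ?_⟩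
    show f _ = _
    rw [hw]
    simp only [hψ]
    rw [Finset.sum_add_distrib, Finset.sum_comm]

theorem subfn_trans (z : A) {f g h : Op A} (h1 : Subfn (B A 1) f g) (h2 : Subfn (B A 1) g h) :
    Subfn (B A 1) f h := by
  obtain ⟨p, hp, hp'⟩ := h1
  obtain ⟨q, hq, hq'⟩ := h2
  refine ⟨fun i a => q i fun j => p j a, fun i => b1_closed z _ _ _ _ (hq i) hp, fun a => ?_⟩
  rw [hp', hq']

theorem b1_data {n : ℕ} (z : A) (f : (Fin n → A) → A) (hf : (⟨n, f⟩ : Op A) ∈ B A 1) :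
    ∃ (T : Finset (Fin n)) (φ : Fin n → A → ZMod 2), T.card ≤ 1 ∧ (∀ j, φ j z = 0) ∧
      ∀ a b : Fin n → A, (∀ j ∈ T, a j = b j) → ∑ j, φ j (a j) = ∑ j, φ j (b j) → f a = f b := by
  rcases b1_cases z f hf with ⟨j, u, h⟩ | ⟨h, w, hw⟩
  · refine ⟨{j}, fun _ _ => 0, by simp, by simp, fun a b hab _ => ?_⟩
    rw [h, h, hab j (by simp)]
  · refine ⟨∅, fun j x => h j x - h j z, by simp, by simp, fun a b _ hab => ?_⟩
    rw [hw, hw]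
    simp only [Finset.sum_sub_distrib, sub_left_inj] at hab
    rw [hab]

theorem class_reduce [Fintype A] [DecidableEq A] (z : A) {n : ℕ} (J : Finset (Fin n)) :
    ∃ (K : Finset (Fin n)) (p : Fin n → (Fin n → A) → A), K.card ≤ Fintype.card A ∧
      (∀ j, (⟨n, p j⟩ : Op A) ∈ B A 1) ∧ (∀ j, j ∉ K → ∀ x, p j x = z) ∧
      ∀ (φ : A → ZMod 2), φ z = 0 → ∀ x, ∑ j ∈ J, φ (p j x) = ∑ j ∈ J, φ (x j) := by
  classical
  by_cases hJ : J.card ≤ Fintype.card A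
  · refine ⟨J, fun j x => if j ∈ J then x j else z, hJ, fun j => ?_, fun j hj x => by simp [hj],
      fun φ _ x => Finset.sum_congr rfl fun j hj => by simp [hj]⟩
    by_cases hj : j ∈ J
    · simpa [hj] using b1_unary j (id : A → A)
    · simpa [hj] using b1_const z
  · push Not at hJ
    obtain ⟨ι⟩ : Nonempty (A ↪ J) :=
      Function.Embedding.nonempty_of_card_le (by simpa using hJ.le)
    let κ : A ↪ Fin n := ι.trans (Function.Embedding.subtype _)
    have hκ : ∀ c, κ c ∈ J := fun c => (ι c).2
    let G : A → (Fin n → A) → A := fun c x =>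
      if (∑ j, if j ∈ J ∧ x j = c then (1 : ZMod 2) else 0) = 1 then c else z
    have hG : ∀ c, (⟨n, G c⟩ : Op A) ∈ B A 1 := fun c =>
      Or.inr ⟨fun j y => if j ∈ J ∧ y = c then (1 : ZMod 2) else 0,
        fun s => if s = 1 then c else z, fun _ => rfl⟩
    let p : Fin n → (Fin n → A) → A := Function.extend κ G (fun _ _ => z)
    have hp1 : ∀ c, p (κ c) = G c := fun c => κ.injective.extend_apply _ _ _
    have hp2 : ∀ j, (¬ ∃ c, κ c = j) → p j = fun _ => z := fun j hj =>
      Function.extend_apply' _ _ _ hj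
    refine ⟨univ.map κ, p, by simp, fun j => ?_, fun j hj x => ?_, fun φ hφ x => ?_⟩
    · by_cases hj : ∃ c, κ c = j
      · obtain ⟨c, rfl⟩ := hj
        rw [hp1]; exact hG c
      · rw [hp2 j hj]; exact b1_const z
    · rw [hp2 j (by simpa using hj)]
    · have hsub : univ.map κ ⊆ J := by
        intro j hj
        simp only [Finset.mem_map, Finset.mem_univ, true_and] at hj
        obtain ⟨c, rfl⟩ := hj
        exact hκ c
      rw [← Finset.sum_subset hsub, Finset.sum_map]
      · have : ∀ c, φ (p (κ c) x) = ∑ j ∈ J, if x j = c then φ c else 0 := by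
          intro c
          rw [hp1]
          have e : ∑ j ∈ J, (if x j = c then φ c else 0)
              = (∑ j, if j ∈ J ∧ x j = c then (1 : ZMod 2) else 0) * φ c := by
            rw [Finset.sum_mul, ← Finset.sum_filter_add_sum_filter_not univ (· ∈ J)]
            rw [Finset.sum_eq_zero (s := univ.filter (fun j => ¬ j ∈ J))]
            · simp only [Finset.filter_univ_mem, add_zero]
              refine Finset.sum_congr rfl fun j hj => ?_
              simp [hj]
            · intro j hj
              simp at hj
              simp [hj]
          rw [e]
          show φ (if _ then c else z) = _
          generalize (∑ j, if j ∈ J ∧ x j = c then (1 : ZMod 2) else 0) = s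
          have : s = 0 ∨ s = 1 := by revert s; decide
          rcases this with rfl | rfl <;> simp [hφ]
        simp only [this]
        rw [Finset.sum_comm]
        simp
      · intro j _ hj
        rw [hp2 j (by simpa using hj)]
        exact hφ

theorem reduce_vars [Fintype A] [DecidableEq A] (z : A) (f g : Op A) (hfg : Subfn (B A 1) f g) :
    ∃ (K : Finset (Fin f.1)) (p : Fin f.1 → (Fin f.1 → A) → A),
      K.card ≤ g.1 + Fintype.card (Fin g.1 → A → ZMod 2) * Fintype.card A ∧
      (∀ j, (⟨f.1, p j⟩ : Op A) ∈ B A 1) ∧ (∀ j, j ∉ K → ∀ x, p j x = z) ∧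
      ∀ x, f.2 (fun j => p j x) = f.2 x := by
  classical
  obtain ⟨n, f⟩ := f
  obtain ⟨m, g⟩ := g
  obtain ⟨h, hh, hf⟩ := hfg
  dsimp only at *
  choose T φ hT hφ hdet using fun i => b1_data z (h i) (hh i)
  let S : Finset (Fin n) := univ.biUnion T
  let σ : Fin n → (Fin m → A → ZMod 2) := fun j i => φ i j
  choose K p hK hp hpz hsum using fun Φ : Fin m → A → ZMod 2 =>
    class_reduce z (univ.filter fun j => j ∉ S ∧ σ j = Φ)
  refine ⟨S ∪ univ.biUnion K, fun j x => if j ∈ S then x j else p (σ j) j x, ?_, ?_, ?_, ?_⟩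
  · refine (Finset.card_union_le _ _).trans (Nat.add_le_add ?_ ?_)
    · exact (Finset.card_biUnion_le_card_mul _ _ 1 fun i _ => hT i).trans (by simp)
    · exact (Finset.card_biUnion_le_card_mul _ _ _ fun i _ => hK i).trans (by simp)
  · intro j
    by_cases hj : j ∈ S
    · simpa [hj] using b1_unary j (id : A → A)
    · simpa [hj] using hp (σ j) j
  · intro j hj x
    simp only [Finset.mem_union, Finset.mem_biUnion, Finset.mem_univ, true_and, not_or,
      not_exists] at hj
    beta_reduce
    rw [if_neg hj.1]
    exact hpz _ _ (hj.2 _) x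
  · intro x
    rw [hf, hf]
    congr 1
    funext i
    apply hdet
    · intro j hj
      have : j ∈ S := Finset.mem_biUnion.2 ⟨i, Finset.mem_univ _, hj⟩
      simp [this]
    · rw [← Finset.sum_filter_add_sum_filter_not univ (· ∈ S),
        ← Finset.sum_filter_add_sum_filter_not univ (· ∈ S) (fun j => φ i j (x j))]
      congr 1
      · refine Finset.sum_congr rfl fun j hj => ?_
        beta_reduce
        rw [if_pos (by simpa using hj)]
      · rw [← Finset.sum_fiberwise _ σ, ← Finset.sum_fiberwise _ σ]
        refine Finset.sum_congr rfl fun Φ _ => ?_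
        rw [Finset.filter_filter]
        by_cases hne : Φ i z = 0
        · refine Eq.trans ?_ ((hsum Φ (Φ i) hne x).trans ?_)
          · refine Finset.sum_congr rfl fun j hj => ?_
            obtain ⟨h1, h2⟩ := (Finset.mem_filter.1 hj).2
            beta_reduce
            rw [if_neg h1, ← h2]
          · refine Finset.sum_congr rfl fun j hj => ?_
            obtain ⟨h1, h2⟩ := (Finset.mem_filter.1 hj).2
            rw [← h2]
        · refine Finset.sum_congr rfl fun j hj => ?_
          obtain ⟨h1, h2⟩ := (Finset.mem_filter.1 hj).2
          exact (hne (by rw [← h2]; exact hφ i j)).elim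

theorem equiv_bounded [Fintype A] [DecidableEq A] (z : A) (g : Op A) :
    ∃ N : ℕ, ∀ f : Op A, Subfn (B A 1) f g →
      ∃ f' : (Fin N → A) → A, EquivC (B A 1) f ⟨N, f'⟩ := by
  classical
  refine ⟨g.1 + Fintype.card (Fin g.1 → A → ZMod 2) * Fintype.card A, fun f hfg => ?_⟩
  obtain ⟨K, p, hK, hp, hpz, hfp⟩ := reduce_vars z f g hfg
  generalize g.1 + Fintype.card (Fin g.1 → A → ZMod 2) * Fintype.card A = N at *
  obtain ⟨e⟩ : Nonempty (K ↪ Fin N) :=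
      Function.Embedding.nonempty_of_card_le (by simpa using hK)
  let q : Fin N → (Fin f.1 → A) → A := Function.extend e (fun j => p j.1) (fun _ _ => z)
  have hq1 : ∀ j, q (e j) = p j.1 := fun c => e.injective.extend_apply _ _ _
  have hq2 : ∀ t, (¬ ∃ j, e j = t) → q t = fun _ => z := fun j hj =>
    Function.extend_apply' _ _ _ hj
  refine ⟨fun y => f.2 fun j => if hj : j ∈ K then y (e ⟨j, hj⟩) else z, ⟨q, ?_, ?_⟩,
    ⟨fun j y => if hj : j ∈ K then y (e ⟨j, hj⟩) else z, ?_, fun a => rfl⟩⟩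
  · intro t
    by_cases ht : ∃ j, e j = t
    · obtain ⟨j, rfl⟩ := ht
      rw [hq1]; exact hp _
    · rw [hq2 t ht]; exact b1_const z
  · intro a
    rw [← hfp a]
    refine congrArg f.2 ?_
    funext j
    by_cases hj : j ∈ K
    · simp [hj, hq1]
    · simp [hj, hpz]
  · intro j
    by_cases hj : j ∈ K
    · simpa [hj] using b1_unary (e ⟨j, hj⟩) (id : A → A)
    · simpa [hj] using b1_const z

end Aux

/-- `⊑_{B_1}` satisfies the descending chain condition: there is no infinite
sequence of operations each a proper `B_1`-subfunction of the previous one. -/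
theorem B1_descending_chain_condition (k : ℕ) (hk : 2 ≤ k) :
    ¬ ∃ f : ℕ → Op (Fin k), ∀ n : ℕ, ProperSubfn (B (Fin k) 1) (f (n + 1)) (f n) := by
  rintro ⟨f, hf⟩
  let z : Fin k := ⟨0, by omega⟩
  have hrefl : ∀ g : Op (Fin k), Subfn (B (Fin k) 1) g g := fun g =>
    ⟨fun i a => a i, fun i => b1_unary i id, fun _ => rfl⟩
  have hmono : ∀ n d, Subfn (B (Fin k) 1) (f (n + d)) (f n) := by
    intro n d
    induction d with
    | zero => exact hrefl _
    | succ d ih => exact subfn_trans z (hf (n + d)).1 ih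
  obtain ⟨N, hN⟩ := equiv_bounded z (f 0)
  choose F hF using fun n => hN (f n) (by simpa using hmono 0 n)
  have main : ∀ a b, a < b → F a = F b → False := by
    intro a b hab he
    apply (hf a).2
    have h1 := (hF a).1
    rw [he] at h1
    have h2 := subfn_trans z h1 (hF b).2
    obtain ⟨d, rfl⟩ := Nat.exists_eq_add_of_lt hab
    have h3 := hmono (a + 1) d
    rw [show a + 1 + d = a + d + 1 by omega] at h3
    exact subfn_trans z h2 h3
  obtain ⟨a, b, hab, he⟩ := Finite.exists_ne_map_eq_of_infinite F
  rcases lt_or_gt_of_ne hab with h | h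
  · exact main a b h he
  · exact main b a h he.symm

end PaperSubfn
end

section
/- Let A be a finite set with k ≥ 3 elements. Then there is an infinite antichain for ⊑_{B_{k−2}}: an infinite set of operations on A that are pairwise B_{k−2}-incomparable. -/
namespace PaperSubfn

variable {A : Type*}

/-- At most one coordinate equals one. -/
def AM {n : ℕ} (x : Fin n → ZMod 2) : Prop := ∀ i j, x i = 1 → x j = 1 → i = j

lemma z2 (b : ZMod 2) : b = 0 ∨ b = 1 := by revert b; decide

lemma z2_third (a b c : ZMod 2) (h1 : a ≠ c) (h2 : b ≠ c) : a = b := by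
  revert a b c; decide

lemma AM_zero {n : ℕ} : AM (0 : Fin n → ZMod 2) := by
  intro i j h; simp at h

lemma AM_single {n : ℕ} (j : Fin n) : AM (Pi.single j 1 : Fin n → ZMod 2) := by
  intro a b ha hb
  have h : ∀ c, (Pi.single j 1 : Fin n → ZMod 2) c = 1 → c = j := by
    intro c hc
    by_contra hne
    simp [Pi.single_apply, hne] at hc
  rw [h a ha, h b hb]

lemma AM_cases {n : ℕ} (x : Fin n → ZMod 2) (h : AM x) :
    x = 0 ∨ ∃ j, x = Pi.single j 1 := by
  by_cases h0 : ∃ j, x j = 1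
  · obtain ⟨j, hj⟩ := h0
    right
    refine ⟨j, ?_⟩
    funext i
    by_cases hij : i = j
    · subst hij; simp [hj]
    · rw [Pi.single_apply, if_neg hij]
      rcases z2 (x i) with h1 | h1
      · exact h1
      · exact absurd (h i j h1 hj) hij
  · left
    funext i
    rcases z2 (x i) with h1 | h1
    · exact h1
    · exact absurd ⟨i, h1⟩ h0

/-- A map that is affine over the two element field vanishes if its linear part vanishes
on unit vectors. -/
lemma affine_const {n : ℕ} (s : (Fin n → ZMod 2) → ZMod 2)
    (hs : ∀ x y, s (x + y) = s x + s y + s 0)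
    (h : ∀ j, s (Pi.single j 1) = s 0) : ∀ x, s x = s 0 := by
  have two : ∀ a : ZMod 2, a + a = 0 := by decide
  let M : (Fin n → ZMod 2) →+ ZMod 2 :=
    { toFun := fun x => s x + s 0
      map_zero' := two _
      map_add' := fun x y => by
        rw [hs]
        generalize s x = a
        generalize s y = b
        generalize s 0 = c
        revert a b c; decide }
  have hM : M = 0 := by
    apply AddMonoidHom.functions_ext'
    intro j
    apply AddMonoidHom.ext
    intro b
    change s (Pi.single j b) + s 0 = 0
    rcases z2 b with rfl | rfl
    · rw [Pi.single_zero]; exact two _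
    · rw [h]; exact two _
  intro x
  have h1 : s x + s 0 = 0 := DFunLike.congr_fun hM x
  revert h1
  generalize s x = a
  generalize s 0 = b
  revert a b; decide

lemma core {n m : ℕ} (L : (Fin n → ZMod 2) → (Fin m → ZMod 2))
    (haff : ∀ i x y, L (x + y) i = L x i + L y i + L 0 i)
    (h1 : ∀ x, AM x → AM (L x)) (h2 : ∀ x, AM (L x) → AM x)
    (h3 : L 1 = 1) (h4 : ∀ x, L x = 1 → x = 1) : n ≤ m ∧ m ≤ n + 1 := by
  constructor
  · have hinj : Function.Injective L := by
      intro x y hxy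
      have e : L (x + y) = L 0 := by
        funext i
        rw [haff, hxy]
        generalize L y i = a
        generalize L 0 i = b
        revert a b; decide
      have hA : AM (x + y) := by
        apply h2; rw [e]; exact h1 _ AM_zero
      rcases AM_cases _ hA with h0 | ⟨j, hj⟩
      · funext i
        have := congrFun h0 i
        simp only [Pi.add_apply, Pi.zero_apply] at this
        revert this
        generalize x i = a
        generalize y i = b
        revert a b; decide
      · exfalso
        rw [hj] at e
        have e2 : L (1 + Pi.single j 1) = 1 := by
          funext i
          rw [haff, e, h3]
          generalize L 0 i = b
          simp only [Pi.one_apply]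
          revert b; decide
        have := congrFun (h4 _ e2) j
        simp at this
    have := Fintype.card_le_of_injective L hinj
    simp only [Fintype.card_pi, ZMod.card, Finset.prod_const, Finset.card_univ,
      Fintype.card_fin] at this
    exact (Nat.pow_le_pow_iff_right (by norm_num)).1 this
  · let pt : Option (Fin n) → (Fin n → ZMod 2) := fun o => o.elim 0 (fun j => Pi.single j 1)
    have hpt : ∀ o, AM (pt o) := by
      intro o
      cases o with
      | none => exact AM_zero
      | some j => exact AM_single j
    have hex : ∀ i, ∃ o, L (pt o) i = 1 := by
      intro i
      by_contra hcon
      push Not at hcon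
      have hz : ∀ o, L (pt o) i = 0 := fun o => (z2 _).resolve_right (hcon o)
      have := affine_const (fun x => L x i) (haff i)
        (fun j => (hz (some j)).trans (hz none).symm) 1
      have h0 : L 0 i = 0 := hz none
      simp [h3, h0] at this
    choose o ho using hex
    have hinj : Function.Injective o := by
      intro a b hab
      exact h1 _ (hpt (o a)) a b (ho a) (by rw [hab]; exact ho b)
    have := Fintype.card_le_of_injective o hinj
    simpa using this

/-- The embedding of the two element field as the elements 1, 2. -/
def io (K : ℕ) (b : ZMod 2) : Fin (K + 3) := if b = 1 then ⟨2, by omega⟩ else ⟨1, by omega⟩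

lemma io_one (K : ℕ) : io K 1 = ⟨2, by omega⟩ := by simp [io]

lemma io_zero (K : ℕ) : io K 0 = ⟨1, by omega⟩ := by simp [io]

lemma io_inj (K : ℕ) : Function.Injective (io K) := by
  intro a b h
  rcases z2 a with rfl | rfl <;> rcases z2 b with rfl | rfl <;> simp [io] at h ⊢

open Classical in
/-- The operations of the antichain. -/
noncomputable def F (K N : ℕ) (y : Fin (N + 2) → Fin (K + 3)) : Fin (K + 3) :=
  if 2 ≤ (y 0).val ∧ ∀ i, y i = y 0 then y 0
  else if ∃ x, AM x ∧ y = fun i => io K (x i) then ⟨1, by omega⟩ else ⟨0, by omega⟩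

lemma F_const (K N : ℕ) (a : Fin (K + 3)) (ha : 2 ≤ a.val) : F K N (fun _ => a) = a := by
  simp [F, ha]

lemma F_eq (K N : ℕ) (y : Fin (N + 2) → Fin (K + 3)) (a : Fin (K + 3)) (ha : 2 ≤ a.val)
    (h : F K N y = a) : ∀ i, y i = a := by
  unfold F at h
  split_ifs at h with h1 h2
  · intro i; rw [h1.2 i, h]
  · subst h; simp at ha
  · subst h; simp at ha

lemma F_am (K N : ℕ) (x : Fin (N + 2) → ZMod 2) (hx : AM x) :
    F K N (fun i => io K (x i)) = ⟨1, by omega⟩ := by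
  unfold F
  rw [if_neg, if_pos ⟨x, hx, rfl⟩]
  rintro ⟨h1, h2⟩
  have h0 : x 0 = 1 := by
    rcases z2 (x 0) with h | h
    · simp [h, io] at h1
    · exact h
  have h3 : x 1 = 1 := by
    rw [io_inj K (h2 1), h0]
  have := hx 0 1 h0 h3
  simp at this

lemma F_eq_one (K N : ℕ) (y : Fin (N + 2) → Fin (K + 3))
    (h : F K N y = ⟨1, by omega⟩) : ∃ x, AM x ∧ y = fun i => io K (x i) := by
  unfold F at h
  split_ifs at h with h1 h2
  · rw [h] at h1; simp at h1
  · exact h2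
  · simp at h

lemma essUnary_form {A : Type*} {n : ℕ} (f : (Fin (n + 1) → A) → A)
    (h : EssUnary (⟨n + 1, f⟩ : Op A)) : ∃ j, ∀ a b, a j = b j → f a = f b := by
  classical
  have : ∃ j, ∀ i, i ≠ j → ¬ essAt f i := by
    by_cases hx : ∃ j, essAt f j
    · obtain ⟨j, hj⟩ := hx
      exact ⟨j, fun i hi he => hi (h he hj)⟩
    · exact ⟨0, fun i _ he => hx ⟨i, he⟩⟩
  obtain ⟨j, hj⟩ := this
  refine ⟨j, fun a b hab => ?_⟩
  have key : ∀ s : Finset (Fin (n + 1)), f (s.piecewise a b) = f b := by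
    intro s
    induction s using Finset.induction_on with
    | empty => simp
    | insert i s his ih =>
      rw [← ih]
      by_cases hij : i = j
      · congr 1
        funext c
        by_cases hc : c = i
        · subst hc
          simp [Finset.piecewise, his]
          rw [hij, hab]
        · simp [Finset.piecewise, hc]
      · by_contra hne
        refine hj i hij ⟨_, _, ?_, hne⟩
        intro c hc
        simp [Finset.piecewise, hc]
  have := key Finset.univ
  simpa using this

lemma main_step (K N M : ℕ)
    (h : Subfn (B (Fin (K + 3)) (K + 1)) ⟨N + 2, F K N⟩ ⟨M + 2, F K M⟩) :
    N ≤ M ∧ M ≤ N + 1 := by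
  obtain ⟨h, hB, hF⟩ := h
  change Fin (M + 2) → (Fin (N + 2) → Fin (K + 3)) → Fin (K + 3) at h
  change ∀ a : Fin (N + 2) → Fin (K + 3), F K N a = F K M (fun i => h i a) at hF
  -- basic facts
  have hc : ∀ a : Fin (K + 3), 2 ≤ a.val → ∀ i, h i (fun _ => a) = a := by
    intro a ha
    apply F_eq K M _ a ha
    rw [← hF, F_const K N a ha]
  have ham : ∀ x, AM x → ∃ y, AM y ∧ ∀ i, h i (fun j => io K (x j)) = io K (y i) := by
    intro x hx
    obtain ⟨y, hy, e⟩ := F_eq_one K M (fun i => h i (fun j => io K (x j)))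
      (by rw [← hF, F_am K N x hx])
    exact ⟨y, hy, fun i => congrFun e i⟩
  -- two different coordinates cannot both be 2 at an AM point
  have hone : ∀ x, AM x → ∀ i i', h i (fun j => io K (x j)) = ⟨2, by omega⟩ →
      h i' (fun j => io K (x j)) = ⟨2, by omega⟩ → i = i' := by
    intro x hx i i' h1 h2
    obtain ⟨y, hy, e⟩ := ham x hx
    apply hy
    · apply io_inj K; rw [← e, h1, io_one]
    · apply io_inj K; rw [← e, h2, io_one]
  have hun : ∀ i, EssUnary (⟨N + 2, h i⟩ : Op (Fin (K + 3))) →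
      ∃ s : (Fin (N + 2) → ZMod 2) → ZMod 2, (∀ x y, s (x + y) = s x + s y + s 0) ∧
        ∀ x, h i (fun j => io K (x j)) = io K (s x) := by
    intro i hi
    obtain ⟨j, hj⟩ := essUnary_form (h i) hi
    obtain ⟨y, hy, e⟩ := ham 0 AM_zero
    refine ⟨fun x => y i + (1 + y i) * x j, ?_, ?_⟩
    · intro x z
      simp only [Pi.add_apply, Pi.zero_apply]
      generalize y i = a
      generalize x j = b
      generalize z j = c
      revert a b c; decide
    · intro x
      beta_reduce
      rcases z2 (x j) with hx | hx
      · rw [hx, hj _ (fun j => io K ((0 : Fin (N + 2) → ZMod 2) j)) (by simp [hx]), e]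
        simp
      · rw [hx, hj _ (fun _ => io K 1) (by simp [hx]), io_one, hc _ (by simp)]
        have : y i + (1 + y i) * 1 = 1 := by
          generalize y i = a
          revert a; decide
        rw [this, io_one]
  have hall : ∀ i, ∃ s : (Fin (N + 2) → ZMod 2) → ZMod 2,
      (∀ x y, s (x + y) = s x + s y + s 0) ∧
        ∀ x, h i (fun j => io K (x j)) = io K (s x) := by
    intro i
    cases K with
    | zero =>
      rcases hB i with hi | hi
      · exact hun i hi
      · obtain ⟨φ, g, hg⟩ := hi
        change Fin (N + 2) → Fin 3 → ZMod 2 at φ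
        change ∀ a : Fin (N + 2) → Fin 3, h i a = g (∑ j, φ j (a j)) at hg
        let s : (Fin (N + 2) → ZMod 2) → ZMod 2 := fun x => ∑ j, φ j (io 0 (x j))
        have hs : ∀ x y, s (x + y) = s x + s y + s 0 := by
          intro x y
          simp only [s, ← Finset.sum_add_distrib]
          apply Finset.sum_congr rfl
          intro j _
          simp only [Pi.add_apply, Pi.zero_apply]
          rcases z2 (x j) with hx | hx <;> rcases z2 (y j) with hy | hy <;> rw [hx, hy] <;>
            have h11 : (1 + 1 : ZMod 2) = 0 := by decide
          · rw [add_zero]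
            generalize φ j (io 0 0) = a
            revert a; decide
          · rw [zero_add]
            generalize φ j (io 0 0) = a
            generalize φ j (io 0 1) = b
            revert a b; decide
          · rw [add_zero]
            generalize φ j (io 0 0) = a
            generalize φ j (io 0 1) = b
            revert a b; decide
          · rw [h11]
            generalize φ j (io 0 0) = a
            generalize φ j (io 0 1) = b
            revert a b; decide
        have hgs : ∀ x, h i (fun j => io 0 (x j)) = g (s x) := fun x => hg _
        have hval : ∀ x, ∃ b, g (s x) = io 0 b := by
          intro x
          have hAM : ∀ z, AM z → ∃ b, g (s z) = io 0 b := by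
            intro z hz
            obtain ⟨y, _, e⟩ := ham z hz
            exact ⟨y i, by rw [← hgs, e]⟩
          by_cases hx : s x = s 0
          · rw [hx]; exact hAM 0 AM_zero
          · have : ∃ j, s (Pi.single j 1) ≠ s 0 := by
              by_contra hcon
              push Not at hcon
              exact hx (affine_const s hs hcon x)
            obtain ⟨j, hj⟩ := this
            rw [z2_third _ _ _ hx hj]
            exact hAM _ (AM_single j)
        -- an arbitrary function of `s`
        let t : ZMod 2 → ZMod 2 := fun b => if g b = io 0 1 then 1 else 0
        refine ⟨fun x => t (s x), ?_, ?_⟩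
        · intro x y
          simp only [hs x y]
          generalize s x = a
          generalize s y = b
          generalize s 0 = c
          generalize t = t
          revert a b c t
          decide
        · intro x
          rw [hgs]
          obtain ⟨b, hb⟩ := hval x
          rcases z2 b with rfl | rfl
          · simp only [t, hb]
            rw [if_neg]
            intro hh
            exact absurd (io_inj 0 hh) (by decide)
          · simp only [t, hb, if_true]
    | succ K =>
      rcases hB i with hi | hi
      · exact hun i hi
      · exfalso
        have hbad : ∀ i', (rng (⟨N + 2, h i'⟩ : Op (Fin (K + 1 + 3)))).ncard ≤ K + 2 →
            ∀ x, AM x → h i' (fun j => io (K + 1) (x j)) = ⟨2, by omega⟩ := by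
          intro i' hi' x hx
          obtain ⟨y, _, e⟩ := ham x hx
          rcases z2 (y i') with hy | hy
          · exfalso
            have hsub : {a : Fin (K + 1 + 3) | 1 ≤ a.val} ⊆
                rng (⟨N + 2, h i'⟩ : Op (Fin (K + 1 + 3))) := by
              intro a ha
              rcases Nat.lt_or_ge a.val 2 with h2 | h2
              · refine ⟨_, (e i').trans ?_⟩
                rw [hy, io_zero]
                apply Fin.ext
                have : 1 ≤ a.val := ha
                show 1 = a.val
                omega
              · exact ⟨_, hc a h2 i'⟩
            have hcard := Set.ncard_le_ncard hsub (Set.toFinite _)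
            have : {a : Fin (K + 1 + 3) | 1 ≤ a.val} = {0}ᶜ := by
              ext a
              rw [Set.mem_compl_iff, Set.mem_singleton_iff, Set.mem_setOf_eq, Fin.ext_iff]
              change 1 ≤ a.val ↔ ¬ a.val = 0
              omega
            rw [this, Set.ncard_compl] at hcard
            rw [Set.ncard_singleton, Nat.card_eq_fintype_card, Fintype.card_fin] at hcard
            omega
          · rw [e, hy, io_one]
        have hi2 := hbad i hi
        obtain ⟨i', hne⟩ : ∃ i', i' ≠ i := exists_ne i
        rcases hB i' with hi' | hi'
        · obtain ⟨j, hj⟩ := essUnary_form (h i') hi'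
          refine hne (hone _ (AM_single j) i' i ?_ (hi2 _ (AM_single j)))
          rw [hj _ (fun _ => io (K + 1) 1) (by simp), io_one, hc _ (by simp)]
        · exact hne (hone _ AM_zero i' i (hbad i' hi' _ AM_zero) (hi2 _ AM_zero))
  choose s hs hsv using hall
  have := core (fun x i => s i x) (fun i x y => hs i x y) ?_ ?_ ?_ ?_
  · omega
  · intro x hx
    obtain ⟨y, hy, e⟩ := ham x hx
    have : (fun i => s i x) = y := by
      funext i
      apply io_inj K
      rw [← hsv, e]
    rw [this]; exact hy
  · intro x hx
    have h1 := F_am K M _ hx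
    simp only [← hsv] at h1
    rw [← hF] at h1
    obtain ⟨z, hz, e⟩ := F_eq_one K N _ h1
    have : x = z := by
      funext j
      exact io_inj K (congrFun e j)
    rw [this]; exact hz
  · funext i
    apply io_inj K
    rw [← hsv]
    simp only [Pi.one_apply, io_one]
    exact hc _ (by simp) i
  · intro x hx
    have h1 : F K N (fun j => io K (x j)) = ⟨2, by omega⟩ := by
      rw [hF]
      simp only [hsv]
      have : ∀ i, s i x = 1 := fun i => congrFun hx i
      simp only [this, io_one]
      exact F_const K M _ (by simp)
    funext j
    apply io_inj K
    rw [F_eq K N _ _ (by simp) h1 j, Pi.one_apply, io_one]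

/-- For `k ≥ 3`, there is an infinite antichain of pairwise
`B_{k-2}`-incomparable operations. -/
theorem infinite_antichain_B_k_sub_two (k : ℕ) (hk : 3 ≤ k) :
    ∃ S : Set (Op (Fin k)), S.Infinite ∧ S.Pairwise (Incomp (B (Fin k) (k - 2))) := by
  obtain ⟨K, rfl⟩ : ∃ K, k = K + 3 := ⟨k - 3, by omega⟩
  have e : K + 3 - 2 = K + 1 := by omega
  rw [e]
  refine ⟨Set.range fun t : ℕ => (⟨2 * t + 2, F K (2 * t)⟩ : Op (Fin (K + 3))), ?_, ?_⟩
  · apply Set.infinite_range_of_injective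
    intro a b hab
    have := congrArg Sigma.fst hab
    simp only at this
    omega
  · rintro _ ⟨a, rfl⟩ _ ⟨b, rfl⟩ hne
    have hab : a ≠ b := by
      rintro rfl; exact hne rfl
    constructor
    · intro h
      have := main_step K _ _ h
      omega
    · intro h
      have := main_step K _ _ h
      omega

end PaperSubfn
end
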